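/- arXiv:2407.07870 — 11 statements merged into one kernel-verified Lean document; each statement's English description precedes it below -/
import Mathlib

section
/- Let p and q be positive integers. Then the number of orbits of the natural action of the product of symmetric groups Σ_p × Σ_q on the power set P({1,…,p} × {1,…,q}) satisfies |B_u(p,q)| ≤ (2^{pq/2} / (p!·q!)) · Σ_{α∈Σ_p} Σ_{β∈Σ_q} 2^{c(α)·c(β) − (q/2)·c(α)}, where 2^x denotes the real power for real exponents x. -/
open Pointwise

/-- Number of cycles of a permutation, including singleton cycles (fixed points). -/
def cycleCount {n : ℕ} (σ : Equiv.Perm (Fin n)) : ℕ :=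
  Multiset.card σ.cycleType + (n - σ.support.card)

/-- The monoid homomorphism `Σ_p × Σ_q → Σ_{p×q}` acting coordinatewise. -/
def prodPermHom (p q : ℕ) :
    (Equiv.Perm (Fin p) × Equiv.Perm (Fin q)) →* Equiv.Perm (Fin p × Fin q) where
  toFun g := Equiv.prodCongr g.1 g.2
  map_one' := Equiv.ext fun _ => rfl
  map_mul' _ _ := Equiv.ext fun _ => rfl

/-- The natural action of `Σ_p × Σ_q` on the power set of `{1,…,p} × {1,…,q}`. -/
noncomputable instance bicolorAction (p q : ℕ) :
    MulAction (Equiv.Perm (Fin p) × Equiv.Perm (Fin q)) (Finset (Fin p × Fin q)) :=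
  MulAction.compHom _ (prodPermHom p q)

/-- `|B_u(p,q)|`: the number of orbits of `Σ_p × Σ_q` on `P({1,…,p} × {1,…,q})`. -/
noncomputable def numOrbits (p q : ℕ) : ℕ :=
  Nat.card (Quotient (MulAction.orbitRel (Equiv.Perm (Fin p) × Equiv.Perm (Fin q))
    (Finset (Fin p × Fin q))))

/-- The cycles of a permutation, as equivalence classes of points. -/
abbrev CycleClass {X : Type*} (σ : Equiv.Perm X) : Type _ :=
  Quotient (Equiv.Perm.SameCycle.setoid σ)

theorem sameCycle_out_mk {X : Type*} (σ : Equiv.Perm X) (x : X) :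
    σ.SameCycle (Quotient.mk _ x : CycleClass σ).out x :=
  Quotient.exact (s := Equiv.Perm.SameCycle.setoid σ) (Quotient.out_eq _)

/-- The number of points of a cycle. -/
noncomputable def cycleLength {X : Type*} [Fintype X] (σ : Equiv.Perm X) (a : CycleClass σ) : ℕ :=
  Nat.card {x : X // (Quotient.mk _ x : CycleClass σ) = a}

theorem sum_cycleLength {X : Type*} [Fintype X] (σ : Equiv.Perm X) [Fintype (CycleClass σ)] :
    ∑ a, cycleLength σ a = Fintype.card X := by
  simp only [cycleLength]
  rw [← Nat.card_sigma, Nat.card_congr (Equiv.sigmaFiberEquiv _), Nat.card_eq_fintype_card]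

theorem cycleLength_pos {X : Type*} [Fintype X] (σ : Equiv.Perm X) (a : CycleClass σ) :
    0 < cycleLength σ a :=
  haveI : Nonempty {x : X // (Quotient.mk _ x : CycleClass σ) = a} := ⟨⟨a.out, a.out_eq⟩⟩
  Nat.card_pos

theorem card_cycleClass_eq {X : Type*} [Fintype X] [DecidableEq X] (σ : Equiv.Perm X)
    [Fintype (CycleClass σ)] :
    Fintype.card (CycleClass σ) =
      Multiset.card σ.cycleType + (Fintype.card X - σ.support.card) := by
  have hT : (σ.cycleFactorsFinset.disjSum σ.supportᶜ).card =
      Multiset.card σ.cycleType + (Fintype.card X - σ.support.card) := by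
    simp [Finset.card_disjSum, Equiv.Perm.cycleType_def, Finset.card_compl]
  rw [← hT, ← Finset.card_univ]
  have key : ∀ (a : CycleClass σ) (x : X), σ.SameCycle a.out x → a = Quotient.mk _ x :=
    fun a x h => a.out_eq.symm.trans (Quotient.sound h)
  have hout := sameCycle_out_mk σ
  refine Finset.card_bij (fun a _ => if σ a.out = a.out then Sum.inr a.out
    else Sum.inl (σ.cycleOf a.out)) ?_ ?_ ?_
  · intro a _
    split_ifs with h
    · simpa using h
    · simpa [Equiv.Perm.cycleOf_mem_cycleFactorsFinset_iff] using h
  · intro a _ b _ hab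
    split_ifs at hab with ha hb hb
    · exact Quotient.out_injective (Sum.inr_injective hab)
    · have h := (Equiv.Perm.sameCycle_iff_cycleOf_eq_of_mem_support
        (Equiv.Perm.mem_support.2 ha) (Equiv.Perm.mem_support.2 hb)).2 (Sum.inl_injective hab)
      exact (key a _ h).trans b.out_eq
  · rintro (c | x) hc
    · have hc' : c ∈ σ.cycleFactorsFinset := by simpa using hc
      obtain ⟨x, hx⟩ := (Equiv.Perm.mem_cycleFactorsFinset_iff.1 hc').1.nonempty_support
      have hcx := Equiv.Perm.cycle_is_cycleOf hx hc'
      have hxs : x ∈ σ.support := Equiv.Perm.mem_cycleFactorsFinset_support_le hc' hx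
      refine ⟨Quotient.mk _ x, Finset.mem_univ _, ?_⟩
      rw [if_neg, (hout x).cycleOf_eq, hcx]
      rw [(hout x).apply_eq_self_iff]
      exact Equiv.Perm.mem_support.1 hxs
    · have hx : σ x = x := by simpa using hc
      have : (Quotient.mk _ x : CycleClass σ).out = x := (hout x).eq_of_right hx
      exact ⟨Quotient.mk _ x, Finset.mem_univ _, by simp [this, hx]⟩

theorem cycleCount_eq_card {n : ℕ} (σ : Equiv.Perm (Fin n)) [Fintype (CycleClass σ)] :
    cycleCount σ = Fintype.card (CycleClass σ) := by
  rw [card_cycleClass_eq, Fintype.card_fin, cycleCount]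

theorem mem_iff_mem_of_sameCycle {X : Type*} [DecidableEq X] {σ : Equiv.Perm X} {s : Finset X}
    (hs : σ • s = s) {x y : X} (h : σ.SameCycle x y) : x ∈ s ↔ y ∈ s := by
  obtain ⟨i, rfl⟩ := h
  have hi : σ ^ i • s = s :=
    MulAction.mem_stabilizer_iff.1 (zpow_mem (MulAction.mem_stabilizer_iff.2 hs) i)
  rw [← Finset.smul_mem_smul_finset_iff (σ ^ i), hi, Equiv.Perm.smul_def]

theorem card_fixed_finsets_le {X : Type*} [Fintype X] [DecidableEq X] (σ : Equiv.Perm X) :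
    Nat.card {s : Finset X // σ • s = s} ≤ 2 ^ Nat.card (CycleClass σ) := by
  rw [← Set.ncard_univ (CycleClass σ), ← Set.ncard_powerset _, Set.powerset_univ, Set.ncard_univ]
  refine Nat.card_le_card_of_injective
    (fun s : {s : Finset X // σ • s = s} => {a : CycleClass σ | a.out ∈ s.1}) ?_
  intro s t hst
  ext x
  have hx := sameCycle_out_mk σ x
  rw [← mem_iff_mem_of_sameCycle s.2 hx, ← mem_iff_mem_of_sameCycle t.2 hx]
  exact Set.ext_iff.1 hst (Quotient.mk _ x)

section Product

variable {X Y : Type*} (α : Equiv.Perm X) (β : Equiv.Perm Y)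

theorem prodCongr_zpow_apply (i : ℤ) (z : X × Y) :
    ((Equiv.prodCongr α β : Equiv.Perm (X × Y)) ^ i) z = ((α ^ i) z.1, (β ^ i) z.2) := by
  let f : Equiv.Perm X × Equiv.Perm Y →* Equiv.Perm (X × Y) :=
    { toFun g := Equiv.prodCongr g.1 g.2
      map_one' := rfl
      map_mul' _ _ := rfl }
  have h := map_zpow f (α, β) i
  exact (congrArg (fun g : Equiv.Perm (X × Y) => g z) h).symm

/-- The pair of cycles through the two coordinates of the points of a cycle of a product. -/
def cycleProj (c : CycleClass (Equiv.prodCongr α β : Equiv.Perm (X × Y))) :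
    CycleClass α × CycleClass β :=
  Quotient.lift (fun z : X × Y => ((Quotient.mk _ z.1 : CycleClass α),
    (Quotient.mk _ z.2 : CycleClass β))) (by
      rintro z _ ⟨i, rfl⟩
      rw [prodCongr_zpow_apply]
      exact Prod.ext (Quotient.sound ⟨i, rfl⟩) (Quotient.sound ⟨i, rfl⟩)) c

theorem card_cycleProj_fiber_le_right [Fintype X] [Fintype Y] (a : CycleClass α)
    (b : CycleClass β) : Nat.card {c // cycleProj α β c = (a, b)} ≤ cycleLength β b := by
  let f : {y : Y // (Quotient.mk _ y : CycleClass β) = b} → {c // cycleProj α β c = (a, b)} :=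
    fun y => ⟨Quotient.mk _ (a.out, y.1), Prod.ext a.out_eq y.2⟩
  refine Nat.card_le_card_of_surjective f ?_
  rintro ⟨⟨x, y⟩, h⟩
  have hx : α.SameCycle x a.out := Quotient.exact ((Prod.ext_iff.1 h).1.trans a.out_eq.symm)
  obtain ⟨i, hi⟩ := hx
  refine ⟨⟨(β ^ i) y, ?_⟩, Subtype.ext (Quotient.sound ?_)⟩
  · rw [← show (Quotient.mk _ y : CycleClass β) = b from (Prod.ext_iff.1 h).2]
    exact Quotient.sound (Equiv.Perm.SameCycle.symm ⟨i, rfl⟩)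
  · exact Equiv.Perm.SameCycle.symm ⟨i, by rw [prodCongr_zpow_apply, hi]⟩

theorem card_cycleProj_fiber_le_left [Fintype X] [Fintype Y] (a : CycleClass α)
    (b : CycleClass β) : Nat.card {c // cycleProj α β c = (a, b)} ≤ cycleLength α a := by
  let f : {x : X // (Quotient.mk _ x : CycleClass α) = a} → {c // cycleProj α β c = (a, b)} :=
    fun x => ⟨Quotient.mk _ (x.1, b.out), Prod.ext x.2 b.out_eq⟩
  refine Nat.card_le_card_of_surjective f ?_
  rintro ⟨⟨x, y⟩, h⟩
  have hy : β.SameCycle y b.out := Quotient.exact ((Prod.ext_iff.1 h).2.trans b.out_eq.symm)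
  obtain ⟨i, hi⟩ := hy
  refine ⟨⟨(α ^ i) x, ?_⟩, Subtype.ext (Quotient.sound ?_)⟩
  · rw [← show (Quotient.mk _ x : CycleClass α) = a from (Prod.ext_iff.1 h).1]
    exact Quotient.sound (Equiv.Perm.SameCycle.symm ⟨i, rfl⟩)
  · exact Equiv.Perm.SameCycle.symm ⟨i, by rw [prodCongr_zpow_apply, hi]⟩

theorem le_half_mul_of_le_of_le {k l m : ℕ} (hl : 0 < l) (hm : 0 < m) (hkl : k ≤ l) (hkm : k ≤ m) :
    (k : ℝ) ≤ l * m / 2 + 1 - m / 2 := by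
  have h : 2 * k + m ≤ l * m + 2 := by
    rcases (by omega : l = 1 ∨ l = 2 ∨ 3 ≤ l) with rfl | rfl | h3
    · omega
    · omega
    · nlinarith [Nat.mul_le_mul_right m h3]
  have h' : (2 * k + m : ℝ) ≤ l * m + 2 := mod_cast h
  linarith

theorem card_cycleClass_prodCongr_le [Fintype X] [Fintype Y] [Fintype (CycleClass α)]
    [Fintype (CycleClass β)] :
    (Nat.card (CycleClass (Equiv.prodCongr α β : Equiv.Perm (X × Y))) : ℝ) ≤
      (Fintype.card X * Fintype.card Y : ℝ) / 2 +
        ((Fintype.card (CycleClass α) : ℝ) * Fintype.card (CycleClass β)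
          - (Fintype.card Y : ℝ) / 2 * Fintype.card (CycleClass α)) := by
  rw [← Nat.card_congr (Equiv.sigmaFiberEquiv (cycleProj α β)), Nat.card_sigma, Nat.cast_sum,
    Fintype.sum_prod_type]
  calc _ ≤ ∑ a, ∑ b, ((cycleLength α a : ℝ) * cycleLength β b / 2 + 1 - cycleLength β b / 2) :=
        Finset.sum_le_sum fun a _ => Finset.sum_le_sum fun b _ =>
          le_half_mul_of_le_of_le (cycleLength_pos α a) (cycleLength_pos β b)
            (card_cycleProj_fiber_le_left α β a b) (card_cycleProj_fiber_le_right α β a b)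
    _ = _ := by
        have hX : (∑ a, (cycleLength α a : ℝ)) = Fintype.card X := mod_cast sum_cycleLength α
        have hY : (∑ b, (cycleLength β b : ℝ)) = Fintype.card Y := mod_cast sum_cycleLength β
        simp only [Finset.sum_sub_distrib, Finset.sum_add_distrib, ← Finset.sum_div,
          ← Finset.mul_sum, ← Finset.sum_mul, hX, hY, Finset.sum_const, Finset.card_univ,
          nsmul_eq_mul]
        ring

end Product

theorem numOrbits_mul_eq (p q : ℕ) :
    numOrbits p q * (p.factorial * q.factorial) =
      ∑ α : Equiv.Perm (Fin p), ∑ β : Equiv.Perm (Fin q),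
        Nat.card {s : Finset (Fin p × Fin q) //
          (Equiv.prodCongr α β : Equiv.Perm (Fin p × Fin q)) • s = s} := by
  classical
  have h := MulAction.sum_card_fixedBy_eq_card_orbits_mul_card_group
    (Equiv.Perm (Fin p) × Equiv.Perm (Fin q)) (Finset (Fin p × Fin q))
  rw [Fintype.card_prod, Fintype.card_perm, Fintype.card_perm, Fintype.card_fin,
    Fintype.card_fin, ← Nat.card_eq_fintype_card, Fintype.sum_prod_type] at h
  refine h.symm.trans (Finset.sum_congr rfl fun α _ => Finset.sum_congr rfl fun β _ => ?_)
  rw [← Nat.card_eq_fintype_card]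
  rfl

theorem bicolored_upper_bound (p q : ℕ) (hp : 0 < p) (hq : 0 < q) :
    (numOrbits p q : ℝ) ≤
      (2 : ℝ) ^ ((p * q : ℝ) / 2) / ((p.factorial : ℝ) * q.factorial) *
        ∑ α : Equiv.Perm (Fin p), ∑ β : Equiv.Perm (Fin q),
          (2 : ℝ) ^ ((cycleCount α : ℝ) * (cycleCount β : ℝ)
            - (q : ℝ) / 2 * (cycleCount α : ℝ)) := by
  classical
  have hpq : (0 : ℝ) < (p.factorial : ℝ) * q.factorial := by positivity
  rw [div_mul_eq_mul_div, le_div_iff₀ hpq, Finset.mul_sum]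
  have h := congrArg (Nat.cast (R := ℝ)) (numOrbits_mul_eq p q)
  push_cast at h
  rw [h]
  refine Finset.sum_le_sum fun α _ => ?_
  rw [Finset.mul_sum]
  refine Finset.sum_le_sum fun β _ => ?_
  rw [← Real.rpow_add two_pos, cycleCount_eq_card α, cycleCount_eq_card β]
  calc _ ≤ ((2 ^ Nat.card (CycleClass
            (Equiv.prodCongr α β : Equiv.Perm (Fin p × Fin q))) : ℕ) : ℝ) :=
        Nat.cast_le.2 (card_fixed_finsets_le _)
    _ ≤ _ := by
        rw [Nat.cast_pow, Nat.cast_ofNat, ← Real.rpow_natCast]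
        refine Real.rpow_le_rpow_of_exponent_le one_le_two ?_
        simpa using card_cycleClass_prodCongr_le α β
end

section
/- Let k be a nonnegative integer. Then limsup_{p→∞} ( |B_u(p,p+k)| · p! · (p+k)! / 2^{p(p+k)} ) ≤ 1; that is, the number of unlabelled bicolored graphs with p red and p+k blue vertices grows asymptotically no faster than 2^{p(p+k)} / (p!·(p+k)!). -/
open Pointwise

open scoped Classical in
/-- A permutation of a finite type has at most `(|α| + |fixed points|) / 2` cycles. -/
theorem two_mul_card_sameCycle_quotient_le {α : Type*} [Fintype α] [DecidableEq α] (π : Equiv.Perm α) :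
    2 * Fintype.card (Quotient (Equiv.Perm.SameCycle.setoid π)) ≤
      Fintype.card α + (Finset.univ.filter fun a => π a = a).card := by
  set Q := Quotient (Equiv.Perm.SameCycle.setoid π)
  let mk : α → Q := Quotient.mk _
  have hfiber (s : Finset α) : s.card = ∑ c : Q, (s.filter fun a => mk a = c).card :=
    Finset.card_eq_sum_card_fiberwise fun _ _ => Finset.mem_univ _
  rw [← Finset.card_univ (α := α), hfiber Finset.univ,
    hfiber (Finset.univ.filter fun a => π a = a), ← Finset.sum_add_distrib, mul_comm,
    ← smul_eq_mul, ← Finset.card_univ]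
  refine Finset.card_nsmul_le_sum _ _ _ fun c _ => ?_
  obtain ⟨a, rfl⟩ := Quotient.exists_rep c
  by_cases ha : π a = a
  · refine Nat.add_le_add (Finset.card_pos.2 ⟨a, ?_⟩) (Finset.card_pos.2 ⟨a, ?_⟩)
    · simp [mk]
    · simp [mk, ha]
  · refine le_add_right (Finset.one_lt_card.2 ⟨a, ?_, π a, ?_, Ne.symm ha⟩)
    · simp [mk]
    · simp only [mk, Finset.mem_filter, Finset.mem_univ, true_and]
      exact Quotient.sound (Equiv.Perm.SameCycle.symm ⟨1, by simp⟩)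

open scoped Classical in
/-- A set invariant under a permutation is a union of cycles. -/
theorem card_smul_eq_self_le {α : Type*} [Fintype α] [DecidableEq α] (π : Equiv.Perm α) :
    Nat.card {S : Finset α // π • S = S} ≤
      2 ^ Fintype.card (Quotient (Equiv.Perm.SameCycle.setoid π)) := by
  set Q := Quotient (Equiv.Perm.SameCycle.setoid π)
  let mk : α → Q := Quotient.mk _
  have hmem (S : {S : Finset α // π • S = S}) (a : α) : mk a ∈ S.1.image mk ↔ a ∈ S.1 := by
    refine ⟨fun h => ?_, fun h => Finset.mem_image_of_mem _ h⟩
    obtain ⟨b, hb, hab⟩ := Finset.mem_image.1 h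
    obtain ⟨i, hi⟩ : π.SameCycle b a := Quotient.exact hab
    have hS : (π ^ i) • S.1 = S.1 :=
      MulAction.mem_stabilizer_iff.1
        (Subgroup.zpow_mem _ (MulAction.mem_stabilizer_iff.2 S.2) i)
    rw [← hS, ← hi]
    exact Finset.smul_mem_smul_finset hb
  rw [← Fintype.card_finset, ← Nat.card_eq_fintype_card]
  refine Nat.card_le_card_of_injective (fun S => S.1.image mk) fun S T hST => ?_
  ext a
  rw [← hmem S, ← hmem T]
  exact iff_of_eq (congrArg (mk a ∈ ·) hST)

open scoped Classical in
/-- The generating function of permutations by number of moved points is dominated by that of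
all self-maps. -/
theorem sum_perm_pow_card_ne_le {n : ℕ} {x : ℝ} (hx : 0 ≤ x) :
    ∑ σ : Equiv.Perm (Fin n), x ^ (Finset.univ.filter fun i => σ i ≠ i).card ≤
      Real.exp ((n : ℝ) ^ 2 * x) := by
  let w : Fin n → Fin n → ℝ := fun i j => if j = i then 1 else x
  have hw (i j) : 0 ≤ w i j := by
    simp only [w]
    split_ifs <;> positivity
  calc ∑ σ : Equiv.Perm (Fin n), x ^ (Finset.univ.filter fun i => σ i ≠ i).card
      = ∑ σ : Equiv.Perm (Fin n), ∏ i, w i (σ i) := by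
        refine Finset.sum_congr rfl fun σ _ => ?_
        simp [w, Finset.prod_ite]
    _ = ∑ f ∈ Finset.univ.image fun σ : Equiv.Perm (Fin n) => (σ : Fin n → Fin n),
          ∏ i, w i (f i) :=
        (Finset.sum_image (f := fun f : Fin n → Fin n => ∏ i, w i (f i))
          (DFunLike.coe_injective (F := Equiv.Perm (Fin n))).injOn).symm
    _ ≤ ∑ f : Fin n → Fin n, ∏ i, w i (f i) :=
        Finset.sum_le_sum_of_subset_of_nonneg (Finset.subset_univ _)
          fun f _ _ => Finset.prod_nonneg fun i _ => hw i _
    _ = ∏ i, ∑ j, w i j := by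
        rw [Finset.prod_univ_sum, Fintype.piFinset_univ]
    _ ≤ ∏ _i : Fin n, Real.exp (n * x) := by
        refine Finset.prod_le_prod (fun i _ => Finset.sum_nonneg fun j _ => hw i j) fun i _ => ?_
        calc ∑ j, w i j ≤ ∑ j, ((if j = i then 1 else 0) + x) := by
              refine Finset.sum_le_sum fun j _ => ?_
              simp only [w]
              split_ifs <;> linarith
          _ = n * x + 1 := by simp [Finset.sum_add_distrib, add_comm]
          _ ≤ Real.exp (n * x) := Real.add_one_le_exp _
    _ = Real.exp ((n : ℝ) ^ 2 * x) := by
        rw [Finset.prod_const, ← Real.exp_nat_mul, Finset.card_univ, Fintype.card_fin]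
        ring_nf

open scoped Classical in
theorem four_mul_card_sameCycle_quotient_le {p q : ℕ} (σ : Equiv.Perm (Fin p))
    (τ : Equiv.Perm (Fin q)) :
    4 * Fintype.card (Quotient (Equiv.Perm.SameCycle.setoid (prodPermHom p q (σ, τ)))) +
      (q * (Finset.univ.filter fun i => σ i ≠ i).card +
        p * (Finset.univ.filter fun j => τ j ≠ j).card) ≤ 4 * (p * q) := by
  have h := two_mul_card_sameCycle_quotient_le (prodPermHom p q (σ, τ))
  have hfix : (Finset.univ.filter fun z => prodPermHom p q (σ, τ) z = z) =
      (Finset.univ.filter fun i => σ i = i) ×ˢ (Finset.univ.filter fun j => τ j = j) := by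
    ext ⟨i, j⟩
    simp [prodPermHom]
  rw [hfix, Finset.card_product, Fintype.card_prod, Fintype.card_fin, Fintype.card_fin] at h
  have hσ := Finset.card_filter_add_card_filter_not (s := Finset.univ) fun i => σ i = i
  have hτ := Finset.card_filter_add_card_filter_not (s := Finset.univ) fun j => τ j = j
  rw [Finset.card_univ, Fintype.card_fin] at hσ hτ
  simp only [ne_eq]
  generalize (Finset.univ.filter fun i => σ i = i).card = f at *
  generalize (Finset.univ.filter fun j => τ j = j).card = g at *
  generalize (Finset.univ.filter fun i => ¬σ i = i).card = s at *
  generalize (Finset.univ.filter fun j => ¬τ j = j).card = t at *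
  subst hσ hτ
  nlinarith [Nat.zero_le (f * t), Nat.zero_le (s * g)]

/-- Burnside's lemma for bicolored graphs. -/
theorem sum_card_smul_eq_self_eq (p q : ℕ) :
    ∑ g : Equiv.Perm (Fin p) × Equiv.Perm (Fin q),
      Nat.card {S : Finset (Fin p × Fin q) // prodPermHom p q g • S = S} =
      numOrbits p q * (p.factorial * q.factorial) := by
  classical
  have h := MulAction.sum_card_fixedBy_eq_card_orbits_mul_card_group
    (Equiv.Perm (Fin p) × Equiv.Perm (Fin q)) (Finset (Fin p × Fin q))
  rw [Fintype.card_prod, Fintype.card_perm, Fintype.card_perm, Fintype.card_fin,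
    Fintype.card_fin, ← Nat.card_eq_fintype_card] at h
  rw [numOrbits, ← h]
  refine Finset.sum_congr rfl fun g _ => ?_
  rw [← Nat.card_eq_fintype_card]
  rfl

theorem numOrbits_ratio_le {a : ℝ} (ha : 0 < a) (ha4 : a ^ 4 = 1 / 2) (p q : ℕ) :
    (numOrbits p q : ℝ) * (p.factorial : ℝ) * (q.factorial : ℝ) / (2 : ℝ) ^ (p * q) ≤
      Real.exp ((p : ℝ) ^ 2 * a ^ q) * Real.exp ((q : ℝ) ^ 2 * a ^ p) := by
  classical
  have ha1 : a ≤ 1 := by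
    by_contra! h
    linarith [one_le_pow₀ h.le (n := 4)]
  have htwo (n : ℕ) : (2 : ℝ) ^ n * a ^ (4 * n) = 1 := by
    rw [pow_mul, ha4, ← mul_pow]
    norm_num
  have hterm (σ : Equiv.Perm (Fin p)) (τ : Equiv.Perm (Fin q)) :
      (Nat.card {S : Finset (Fin p × Fin q) // prodPermHom p q (σ, τ) • S = S} : ℝ) ≤
        2 ^ (p * q) * ((a ^ q) ^ (Finset.univ.filter fun i => σ i ≠ i).card *
          (a ^ p) ^ (Finset.univ.filter fun j => τ j ≠ j).card) := by
    have hcard : (Nat.card {S : Finset (Fin p × Fin q) // prodPermHom p q (σ, τ) • S = S} : ℝ) ≤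
        2 ^ Fintype.card (Quotient (Equiv.Perm.SameCycle.setoid (prodPermHom p q (σ, τ)))) :=
      mod_cast card_smul_eq_self_le (prodPermHom p q (σ, τ))
    refine hcard.trans ?_
    have hc := four_mul_card_sameCycle_quotient_le σ τ
    generalize Fintype.card
      (Quotient (Equiv.Perm.SameCycle.setoid (prodPermHom p q (σ, τ)))) = c at *
    rw [← pow_mul, ← pow_mul, ← pow_add]
    generalize q * _ + p * _ = e at *
    calc (2 : ℝ) ^ c = 2 ^ (p * q) * (2 ^ c * a ^ (4 * (p * q))) := by
          rw [mul_left_comm, htwo, mul_one]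
      _ ≤ 2 ^ (p * q) * (2 ^ c * a ^ (4 * c + e)) := by
          gcongr 2 ^ (p * q) * (2 ^ c * ?_)
          exact pow_le_pow_of_le_one ha.le ha1 hc
      _ = 2 ^ (p * q) * a ^ e := by rw [pow_add, ← mul_assoc (2 ^ c), htwo, one_mul]
  rw [div_le_iff₀ (by positivity), mul_assoc]
  calc (numOrbits p q : ℝ) * (p.factorial * q.factorial)
      = ∑ g : Equiv.Perm (Fin p) × Equiv.Perm (Fin q),
        (Nat.card {S : Finset (Fin p × Fin q) // prodPermHom p q g • S = S} : ℝ) :=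
        mod_cast (sum_card_smul_eq_self_eq p q).symm
    _ ≤ ∑ g : Equiv.Perm (Fin p) × Equiv.Perm (Fin q),
        2 ^ (p * q) * ((a ^ q) ^ (Finset.univ.filter fun i => g.1 i ≠ i).card *
          (a ^ p) ^ (Finset.univ.filter fun j => g.2 j ≠ j).card) :=
        Finset.sum_le_sum fun g _ => hterm g.1 g.2
    _ = (∑ σ : Equiv.Perm (Fin p), (a ^ q) ^ (Finset.univ.filter fun i => σ i ≠ i).card) *
        (∑ τ : Equiv.Perm (Fin q), (a ^ p) ^ (Finset.univ.filter fun j => τ j ≠ j).card) *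
        2 ^ (p * q) := by
        rw [← Finset.mul_sum, Finset.sum_mul_sum, Fintype.sum_prod_type, mul_comm]
    _ ≤ _ := by
        gcongr
        · exact sum_perm_pow_card_ne_le (by positivity)
        · exact sum_perm_pow_card_ne_le (by positivity)

theorem bicolored_growth (k : ℕ) :
    Filter.limsup
      (fun p : ℕ => (numOrbits p (p + k) : ℝ) * (p.factorial : ℝ) * ((p + k).factorial : ℝ) /
        (2 : ℝ) ^ (p * (p + k)))
      Filter.atTop ≤ 1 := by
  obtain ⟨a, ha, ha4⟩ : ∃ a : ℝ, 0 < a ∧ a ^ 4 = 1 / 2 :=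
    ⟨(1 / 2 : ℝ) ^ ((4 : ℕ) : ℝ)⁻¹, by positivity,
      Real.rpow_inv_natCast_pow (by norm_num) (by norm_num)⟩
  have ha1 : |a| < 1 := by
    rw [abs_of_pos ha]
    by_contra! h
    linarith [one_le_pow₀ h (n := 4)]
  have hsq := tendsto_pow_const_mul_const_pow_of_abs_lt_one 2 ha1
  have h₁ : Filter.Tendsto (fun p : ℕ => (p : ℝ) ^ 2 * a ^ (p + k)) Filter.atTop (nhds 0) := by
    simpa only [pow_add, mul_assoc, zero_mul] using hsq.mul_const (a ^ k)
  have h₂ : Filter.Tendsto (fun p : ℕ => ((p + k : ℕ) : ℝ) ^ 2 * a ^ p) Filter.atTop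
      (nhds 0) := by
    have h := ((Filter.tendsto_add_atTop_iff_nat k).2 hsq).mul_const (a ^ k)⁻¹
    rw [zero_mul] at h
    refine h.congr fun p => ?_
    rw [pow_add a p k]
    field_simp
  have hlim : Filter.Tendsto (fun p : ℕ => Real.exp ((p : ℝ) ^ 2 * a ^ (p + k)) *
      Real.exp (((p + k : ℕ) : ℝ) ^ 2 * a ^ p)) Filter.atTop (nhds 1) := by
    simpa using h₁.rexp.mul h₂.rexp
  rw [← hlim.limsup_eq]
  refine Filter.limsup_le_limsup
    (Filter.Eventually.of_forall fun p => numOrbits_ratio_le ha ha4 p (p + k)) ?_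
    hlim.isBoundedUnder_le
  exact (Filter.isBoundedUnder_of ⟨0, fun p => by positivity⟩ :
    Filter.IsBoundedUnder (· ≥ ·) _ _).isCoboundedUnder_le
end

section
/- Let k be a nonnegative integer, and for positive integers p, q let f(p,q) denote the proportion of elements of the power set P({1,…,p} × {1,…,q}) that lie in free orbits of the natural Σ_p × Σ_q-action, i.e., f(p,q) = (number of subsets S ⊆ {1,…,p} × {1,…,q} whose stabilizer in Σ_p × Σ_q is trivial) / 2^{pq}. Then lim_{p→∞} f(p,p+k) = 1. -/
open Pointwise

/-- `f(p,q)`: the proportion of subsets of `{1,…,p} × {1,…,q}` whose stabilizer in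
`Σ_p × Σ_q` is trivial, i.e. which lie in free orbits. -/
noncomputable def freeProportion (p q : ℕ) : ℝ :=
  (Nat.card {S : Finset (Fin p × Fin q) //
      MulAction.stabilizer (Equiv.Perm (Fin p) × Equiv.Perm (Fin q)) S = ⊥} : ℝ) /
    (2 : ℝ) ^ (p * q)

open Finset in
theorem exists_disjoint_smul_card_support_le {α : Type*} [Fintype α] [DecidableEq α]
    (g : Equiv.Perm α) :
    ∃ T : Finset α, (∀ x ∈ T, g x ∉ T) ∧ #g.support ≤ 3 * #T := by
  obtain ⟨T, hT⟩ := Set.Finite.exists_maximal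
    (Set.toFinite {T : Finset α | ∀ x ∈ T, g x ∉ T}) ⟨∅, by simp⟩
  refine ⟨T, hT.prop, ?_⟩
  have hsub : g.support ⊆ T ∪ T.image g ∪ T.image g.symm := by
    intro x hx
    rw [Equiv.Perm.mem_support] at hx
    by_contra hn
    simp only [mem_union, mem_image, not_or, not_exists, not_and] at hn
    obtain ⟨⟨hxT, h1⟩, h2⟩ := hn
    refine hxT (hT.le_of_ge (y := insert x T) ?_ (subset_insert x T) (mem_insert_self x T))
    intro y hy hgy
    rcases mem_insert.1 hy with rfl | hyT
    · rcases mem_insert.1 hgy with h | h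
      · exact hx h
      · exact h2 _ h (by simp)
    · rcases mem_insert.1 hgy with h | h
      · exact h1 _ hyT h
      · exact hT.prop y hyT h
  calc #g.support ≤ #(T ∪ T.image g ∪ T.image g.symm) := card_le_card hsub
    _ ≤ #T + #(T.image g) + #(T.image g.symm) :=
      (card_union_le _ _).trans (Nat.add_le_add_right (card_union_le _ _) _)
    _ ≤ 3 * #T := by
      have h1 := card_image_le (s := T) (f := g)
      have h2 := card_image_le (s := T) (f := g.symm)
      omega

open Finset in
theorem card_invariant_finsets_le {α : Type*} [Fintype α] [DecidableEq α]
    (g : Equiv.Perm α) (T : Finset α) (hT : ∀ x ∈ T, g x ∉ T) :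
    #{S : Finset α | ∀ x, g x ∈ S ↔ x ∈ S} ≤ 2 ^ #Tᶜ := by
  rw [← card_powerset]
  refine card_le_card_of_injOn (fun S => S \ T) ?_ ?_
  · intro S _
    simp only [mem_coe, mem_powerset]
    intro x hx
    simpa using (mem_sdiff.1 hx).2
  · intro S hS S' hS' h
    simp only [coe_filter, mem_univ, true_and, Set.mem_ofPred_eq] at hS hS'
    have key : ∀ x, x ∉ T → (x ∈ S ↔ x ∈ S') := by
      intro x hx
      have := Finset.ext_iff.1 h x
      simpa [hx] using this
    ext x
    by_cases hx : x ∈ T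
    · rw [← hS, ← hS', key _ (hT x hx)]
    · exact key x hx

open Finset in
theorem card_invariant_finsets_div_le {α : Type*} [Fintype α] [DecidableEq α]
    (g : Equiv.Perm α) :
    (#{S : Finset α | ∀ x, g x ∈ S ↔ x ∈ S} : ℝ) / 2 ^ Fintype.card α ≤
      (9 / 10) ^ (2 * #g.support) := by
  obtain ⟨T, hT, hcard⟩ := exists_disjoint_smul_card_support_le g
  have h1 : (#{S : Finset α | ∀ x, g x ∈ S ↔ x ∈ S} : ℝ) ≤ 2 ^ #Tᶜ := by
    exact_mod_cast card_invariant_finsets_le g T hT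
  rw [← card_add_card_compl T, pow_add, div_le_iff₀ (by positivity)]
  have h2 : ((1 : ℝ) / 2) ^ #T ≤ (9 / 10) ^ (2 * #g.support) :=
    calc ((1 : ℝ) / 2) ^ #T ≤ ((9 / 10) ^ 6) ^ #T := by gcongr; norm_num
      _ = (9 / 10) ^ (6 * #T) := by rw [pow_mul]
      _ ≤ _ := pow_le_pow_of_le_one (by norm_num) (by norm_num) (by omega)
  calc _ ≤ (2 : ℝ) ^ #Tᶜ := h1
    _ = (1 / 2) ^ #T * (2 ^ #T * 2 ^ #Tᶜ) := by
      rw [← mul_assoc, ← mul_pow]; norm_num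
    _ ≤ _ := by gcongr

open Finset in
theorem card_support_prodCongr_ge {α β : Type*} [Fintype α] [DecidableEq α] [Fintype β]
    [DecidableEq β] (σ : Equiv.Perm α) (τ : Equiv.Perm β) :
    Fintype.card β * #σ.support + Fintype.card α * #τ.support ≤
      2 * #(Equiv.Perm.support (Equiv.prodCongr σ τ)) := by
  have h : (Equiv.Perm.support (Equiv.prodCongr σ τ))ᶜ = σ.supportᶜ ×ˢ τ.supportᶜ := by
    ext ⟨x, y⟩
    simp [Prod.ext_iff]
  have h' := congrArg card h
  rw [card_product] at h'
  have h1 := card_add_card_compl σ.support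
  have h2 := card_add_card_compl τ.support
  have h3 := card_add_card_compl (Equiv.Perm.support (Equiv.prodCongr σ τ))
  rw [h', Fintype.card_prod, ← h1, ← h2] at h3
  rw [← h1, ← h2]
  nlinarith

open Finset in
theorem sum_perm_pow_card_support_le {α : Type*} [Fintype α] [DecidableEq α] {t : ℝ}
    (ht : 0 ≤ t) :
    ∑ σ : Equiv.Perm α, t ^ #σ.support ≤
      Real.exp (Fintype.card α * (Fintype.card α * t)) := by
  let w (f : α → α) : ℝ := ∏ i, if f i = i then 1 else t
  have hw (f : α → α) : 0 ≤ w f := prod_nonneg fun i _ => by split_ifs <;> positivity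
  calc ∑ σ : Equiv.Perm α, t ^ #σ.support = ∑ σ : Equiv.Perm α, w σ := by
        refine sum_congr rfl fun σ _ => ?_
        simp only [w, prod_ite, prod_const_one, one_mul, prod_const]
        rfl
    _ = ∑ f ∈ univ.map ⟨fun σ : Equiv.Perm α => (σ : α → α), DFunLike.coe_injective⟩, w f := by
        rw [sum_map]; rfl
    _ ≤ ∑ f : α → α, w f := sum_le_sum_of_subset_of_nonneg (subset_univ _) fun f _ _ => hw f
    _ = ∏ i : α, ∑ j : α, if j = i then 1 else t := by
        rw [prod_univ_sum]; simp [w]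
    _ ≤ ∏ _i : α, Real.exp (Fintype.card α * t) := by
        refine prod_le_prod (fun i _ => sum_nonneg fun j _ => by split_ifs <;> positivity)
          fun i _ => ?_
        calc ∑ j : α, (if j = i then 1 else t) ≤ ∑ j : α, ((if j = i then 1 else 0) + t) :=
              sum_le_sum fun j _ => by split_ifs <;> linarith
          _ = Fintype.card α * t + 1 := by simp [sum_add_distrib, add_comm]
          _ ≤ _ := Real.add_one_le_exp _
    _ = _ := by rw [prod_const, card_univ, ← Real.exp_nat_mul]

theorem bicolor_smul_eq_iff {p q : ℕ} (g : Equiv.Perm (Fin p) × Equiv.Perm (Fin q))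
    (S : Finset (Fin p × Fin q)) :
    g • S = S ↔ ∀ x, Equiv.prodCongr g.1 g.2 x ∈ S ↔ x ∈ S := by
  have h : g • S = prodPermHom p q g • S := rfl
  rw [h, eq_comm, Finset.ext_iff, (prodPermHom p q g).surjective.forall]
  exact forall_congr' fun x => by
    rw [← Equiv.Perm.smul_def, Finset.smul_mem_smul_finset_iff]
    rfl

theorem freeProportion_le_one (p q : ℕ) : freeProportion p q ≤ 1 := by
  rw [freeProportion, div_le_one (by positivity)]
  have h := Finite.card_subtype_le (fun S : Finset (Fin p × Fin q) =>
    MulAction.stabilizer (Equiv.Perm (Fin p) × Equiv.Perm (Fin q)) S = ⊥)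
  rw [Nat.card_eq_fintype_card (α := Finset (Fin p × Fin q)), Fintype.card_finset,
    Fintype.card_prod, Fintype.card_fin, Fintype.card_fin] at h
  exact_mod_cast h

open Finset in
theorem two_sub_exp_le_freeProportion (p q : ℕ) :
    2 - Real.exp (p * (p * (9 / 10) ^ q) + q * (q * (9 / 10) ^ p)) ≤ freeProportion p q := by
  classical
  let G := Equiv.Perm (Fin p) × Equiv.Perm (Fin q)
  let inv (g : G) : Finset (Finset (Fin p × Fin q)) :=
    {S | ∀ x, Equiv.prodCongr g.1 g.2 x ∈ S ↔ x ∈ S}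
  let free : Finset (Finset (Fin p × Fin q)) := {S | MulAction.stabilizer G S = ⊥}
  have hfree : freeProportion p q = (#free : ℝ) / 2 ^ (p * q) := by
    rw [freeProportion, Nat.card_eq_fintype_card, Fintype.card_subtype]
  have hcover : freeᶜ ⊆ (univ.erase (1 : G)).biUnion inv := by
    intro S hS
    simp only [free, mem_compl, mem_filter, mem_univ, true_and] at hS
    obtain ⟨⟨g, hg⟩, hg1⟩ := Subgroup.ne_bot_iff_exists_ne_one.1 hS
    have hg1' : g ≠ 1 := fun h => hg1 (Subtype.ext h)
    refine mem_biUnion.2 ⟨g, mem_erase.2 ⟨hg1', mem_univ g⟩, ?_⟩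
    simpa only [inv, mem_filter, mem_univ, true_and] using (bicolor_smul_eq_iff g S).1 hg
  have hcard : (2 : ℝ) ^ (p * q) ≤ #free + ∑ g ∈ univ.erase (1 : G), (#(inv g) : ℝ) := by
    have h1 := (card_le_card hcover).trans card_biUnion_le
    have h2 := card_add_card_compl free
    rw [Fintype.card_finset, Fintype.card_prod, Fintype.card_fin, Fintype.card_fin] at h2
    have h3 : 2 ^ (p * q) ≤ #free + ∑ g ∈ univ.erase (1 : G), #(inv g) := by omega
    exact_mod_cast h3
  let w (g : G) : ℝ := ((9 / 10) ^ q) ^ #g.1.support * ((9 / 10) ^ p) ^ #g.2.support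
  have hinv (g : G) : (#(inv g) : ℝ) / 2 ^ (p * q) ≤ w g := by
    have h1 := card_invariant_finsets_div_le (Equiv.prodCongr g.1 g.2)
    have h2 := card_support_prodCongr_ge g.1 g.2
    rw [Fintype.card_prod, Fintype.card_fin, Fintype.card_fin] at h1
    rw [Fintype.card_fin, Fintype.card_fin] at h2
    refine h1.trans ?_
    simp only [w]
    rw [← pow_mul, ← pow_mul, ← pow_add]
    exact pow_le_pow_of_le_one (by norm_num) (by norm_num) h2
  have hsum : ∑ g : G, w g ≤
      Real.exp (p * (p * (9 / 10) ^ q) + q * (q * (9 / 10) ^ p)) := by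
    rw [Real.exp_add]
    simp only [w, G]
    rw [Fintype.sum_prod_type]
    dsimp only
    rw [← Fintype.sum_mul_sum]
    have h1 := sum_perm_pow_card_support_le (α := Fin p) (t := (9 / 10) ^ q) (by positivity)
    have h2 := sum_perm_pow_card_support_le (α := Fin q) (t := (9 / 10) ^ p) (by positivity)
    rw [Fintype.card_fin] at h1 h2
    exact mul_le_mul h1 h2 (sum_nonneg fun _ _ => by positivity) (Real.exp_nonneg _)
  have hone : w 1 = 1 := by simp [w]
  have herase := sum_erase_add univ w (mem_univ (1 : G))
  have hle : ∑ g ∈ univ.erase (1 : G), (#(inv g) : ℝ) / 2 ^ (p * q) ≤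
      ∑ g ∈ univ.erase (1 : G), w g := sum_le_sum fun g _ => hinv g
  rw [← sum_div] at hle
  have hdiv : (1 : ℝ) ≤ #free / 2 ^ (p * q) +
      (∑ g ∈ univ.erase (1 : G), (#(inv g) : ℝ)) / 2 ^ (p * q) := by
    rw [← add_div, one_le_div (by positivity)]
    exact hcard
  rw [hfree]
  linarith

theorem freeProportion_tendsto_one (k : ℕ) :
    Filter.Tendsto (fun p : ℕ => freeProportion p (p + k)) Filter.atTop (nhds 1) := by
  have hr (m : ℕ) : Filter.Tendsto (fun n : ℕ => (n : ℝ) ^ m * (9 / 10) ^ n)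
      Filter.atTop (nhds 0) :=
    tendsto_pow_const_mul_const_pow_of_abs_lt_one m (by norm_num [abs_of_pos])
  have hexponent : Filter.Tendsto (fun p : ℕ => (p : ℝ) * (p * (9 / 10) ^ (p + k)) +
      (p + k : ℕ) * ((p + k : ℕ) * (9 / 10) ^ p)) Filter.atTop (nhds 0) := by
    have h := (((hr 2).const_mul ((9 / 10) ^ k + 1)).add ((hr 1).const_mul (2 * (k : ℝ)))).add
      ((hr 0).const_mul ((k : ℝ) ^ 2))
    simp only [mul_zero, add_zero] at h
    refine h.congr fun p => ?_
    push_cast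
    ring
  have hlower := (Real.continuous_exp.tendsto 0).comp hexponent |>.const_sub 2
  rw [Real.exp_zero, show (2 : ℝ) - 1 = 1 by norm_num] at hlower
  exact tendsto_of_tendsto_of_tendsto_of_le_of_le hlower tendsto_const_nhds
    (fun p => two_sub_exp_le_freeProportion p (p + k))
    (fun p => freeProportion_le_one p (p + k))
end

section
/- Let p and q be positive integers and let f(p,q) denote the proportion of elements of the power set P({1,…,p} × {1,…,q}) whose stabilizer in Σ_p × Σ_q is trivial. Then f(p,q) ≥ 2 − p!·q!·|B_u(p,q)| / 2^{pq}. -/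
open Pointwise

/-- Burnside's lemma in stabilizer form: the orders of the stabilizers sum to the number of orbits
times the order of the group. -/
theorem MulAction.sum_card_stabilizer_eq_card_orbits_mul_card (G X : Type*) [Group G]
    [MulAction G X] [Finite G] [Fintype X] :
    ∑ x : X, Nat.card (MulAction.stabilizer G x) =
      Nat.card (Quotient (MulAction.orbitRel G X)) * Nat.card G := by
  rw [← Nat.card_sigma, ← Nat.card_prod]
  refine Nat.card_congr (Equiv.trans ?_ (MulAction.sigmaFixedByEquivOrbitsProdGroup G X))
  exact
    { toFun := fun a => ⟨a.2.1, a.1, a.2.2⟩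
      invFun := fun b => ⟨b.2.1, b.1, b.2.2⟩
      left_inv := fun _ => rfl
      right_inv := fun _ => rfl }

/-- Every point in a non-free orbit has a stabilizer of order at least two, so twice the number of
points exceeds `|G| * |X / G|` by at most the number of points with trivial stabilizer. -/
theorem MulAction.two_mul_card_le_card_orbits_mul_card_add_card_free (G X : Type*) [Group G]
    [MulAction G X] [Finite G] [Finite X] :
    2 * Nat.card X ≤ Nat.card (Quotient (MulAction.orbitRel G X)) * Nat.card G +
      Nat.card {x : X // MulAction.stabilizer G x = ⊥} := by
  classical
  have := Fintype.ofFinite X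
  rw [← sum_card_stabilizer_eq_card_orbits_mul_card, Nat.card_eq_fintype_card,
    Nat.card_eq_fintype_card, Fintype.card_subtype, Finset.card_filter, ← Finset.sum_add_distrib,
    mul_comm, ← smul_eq_mul, ← Finset.card_univ, ← Finset.sum_const]
  refine Finset.sum_le_sum fun x _ => ?_
  split_ifs with h
  · simp [h]
  · exact (Subgroup.one_lt_card_iff_ne_bot _).2 h

theorem freeProportion_lower_bound (p q : ℕ) (hp : 0 < p) (hq : 0 < q) :
    freeProportion p q ≥
      2 - (p.factorial : ℝ) * (q.factorial : ℝ) * (numOrbits p q : ℝ) / (2 : ℝ) ^ (p * q) := by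
  have key := MulAction.two_mul_card_le_card_orbits_mul_card_add_card_free
    (Equiv.Perm (Fin p) × Equiv.Perm (Fin q)) (Finset (Fin p × Fin q))
  have hX : Nat.card (Finset (Fin p × Fin q)) = 2 ^ (p * q) := by simp
  have hG : Nat.card (Equiv.Perm (Fin p) × Equiv.Perm (Fin q)) = p.factorial * q.factorial := by
    simp [Fintype.card_perm]
  rw [hX, hG] at key
  have key' := (Nat.cast_le (α := ℝ)).2 key
  push_cast at key'
  rw [ge_iff_le, freeProportion, numOrbits, sub_le_iff_le_add, ← add_div,
    le_div_iff₀ (by positivity)]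
  linarith
end

section
/- Let p be a positive integer and let χ: Σ_p → ℂ be a Dirichlet character on the symmetric group Σ_p. Then χ is cyclic if and only if both of the following hold: (1) for every pair of permutations σ, σ′ ∈ Σ_p with c(σ) = c(σ′), one has χ(σ) = χ(σ′); and (2) for every transposition τ and every cycle γ in Σ_p such that some element of {1,…,p} fixed by γ is not fixed by τ, one has χ(τγ) = χ(τ)·χ(γ). -/
/-- A Dirichlet character on the symmetric group `Σ_p`: a class function `χ : Σ_p → ℂ`
with `χ 1 = 1` and `χ (σ₁σ₂) = χ σ₁ * χ σ₂` whenever `σ₁`, `σ₂` are disjoint. -/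
def IsDirichletChar {p : ℕ} (χ : Equiv.Perm (Fin p) → ℂ) : Prop :=
  (∀ σ τ : Equiv.Perm (Fin p), χ (τ * σ * τ⁻¹) = χ σ) ∧
  χ 1 = 1 ∧
  ∀ σ₁ σ₂ : Equiv.Perm (Fin p), σ₁.Disjoint σ₂ → χ (σ₁ * σ₂) = χ σ₁ * χ σ₂

/-- A Dirichlet character is cyclic if `χ(γ_i) = χ(τ)^(i-1)` for every `i`-cycle `γ_i`
and every transposition `τ`. -/
def IsCyclicDirichletChar {p : ℕ} (χ : Equiv.Perm (Fin p) → ℂ) : Prop :=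
  IsDirichletChar χ ∧
  ∀ (i : ℕ) (γ τ : Equiv.Perm (Fin p)), γ.IsCycle → γ.support.card = i → τ.IsSwap →
    χ γ = χ τ ^ (i - 1)

section

open Equiv Equiv.Perm

/-- A cycle moving `y` is given by a list without duplicates that starts with `y`. -/
theorem Equiv.Perm.IsCycle.exists_formPerm_cons {p : ℕ} {γ : Perm (Fin p)} (hγ : γ.IsCycle)
    {y : Fin p} (hy : γ y ≠ y) :
    ∃ l : List (Fin p), (y :: l).Nodup ∧ 1 ≤ l.length ∧ (y :: l).formPerm = γ := by
  have hf : (toList γ y).formPerm = γ := by rw [formPerm_toList, hγ.cycleOf_eq hy]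
  have hn := nodup_toList γ y
  have h2 : 2 ≤ (toList γ y).length := two_le_length_toList_iff_mem_support.2 (mem_support.2 hy)
  have h0 : (toList γ y)[0]'(by omega) = y := by simp [toList]
  cases hl : toList γ y with
  | nil => simp [hl] at h2
  | cons a l =>
    simp only [hl, List.getElem_cons_zero] at h0
    subst h0
    rw [hl] at hf hn h2
    exact ⟨l, hn, by simpa using h2, hf⟩

theorem List.card_support_formPerm {p : ℕ} {l : List (Fin p)} (hn : l.Nodup)
    (h2 : 2 ≤ l.length) : l.formPerm.support.card = l.length := by
  rw [List.support_formPerm_of_nodup l hn (by rintro x rfl; simp at h2),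
    List.toFinset_card_of_nodup hn]

/-- A cyclic Dirichlet character is determined by its value at a transposition. -/
theorem IsCyclicDirichletChar.apply_eq_pow {p : ℕ} {χ : Perm (Fin p) → ℂ}
    (h : IsCyclicDirichletChar χ) {τ : Perm (Fin p)} (hτ : τ.IsSwap) (σ : Perm (Fin p)) :
    Multiset.card σ.cycleType ≤ σ.support.card ∧
      χ σ = χ τ ^ (σ.support.card - Multiset.card σ.cycleType) := by
  induction σ using cycle_induction_on with
  | base_one => simp [h.1.2.1]
  | base_cycles σ hσ =>
    have := hσ.two_le_card_support
    rw [hσ.cycleType, h.2 _ σ τ hσ rfl hτ]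
    simp only [Multiset.card_singleton, and_true]
    omega
  | induction_disjoint σ π hd _ ihσ ihπ =>
    rw [hd.cycleType_mul, hd.card_support_mul, h.1.2.2 σ π hd, ihσ.2, ihπ.2, ← pow_add,
      Multiset.card_add]
    exact ⟨by omega, by congr 1; omega⟩

theorem IsDirichletChar.apply_eq_of_isSwap {p : ℕ} {χ : Perm (Fin p) → ℂ}
    (hχ : IsDirichletChar χ) {σ τ : Perm (Fin p)} (hσ : σ.IsSwap) (hτ : τ.IsSwap) :
    χ σ = χ τ := by
  obtain ⟨a, b, hab, rfl⟩ := hσ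
  obtain ⟨c, d, hcd, rfl⟩ := hτ
  obtain ⟨π, hπ⟩ := isConj_iff.1 (isConj_swap hab hcd)
  rw [← hπ, hχ.1]

/-- If `χ (τ * γ) = χ τ * χ γ` whenever the transposition `τ` moves a fixed point of the cycle `γ`,
then the value of `χ` at a cycle is a power of its value at a transposition. -/
theorem IsDirichletChar.apply_formPerm {p : ℕ} {χ : Perm (Fin p) → ℂ}
    (hχ : IsDirichletChar χ)
    (h : ∀ τ γ : Perm (Fin p), τ.IsSwap → γ.IsCycle →
      (∃ x : Fin p, γ x = x ∧ τ x ≠ x) → χ (τ * γ) = χ τ * χ γ)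
    {τ : Perm (Fin p)} (hτ : τ.IsSwap) (l : List (Fin p)) (x y : Fin p)
    (hn : (x :: y :: l).Nodup) :
    χ (x :: y :: l).formPerm = χ τ ^ (l.length + 1) := by
  have hxy : x ≠ y := by rintro rfl; simp at hn
  have hs : (swap x y).IsSwap := ⟨x, y, hxy, rfl⟩
  induction l generalizing x y with
  | nil => simpa using hχ.apply_eq_of_isSwap hs hτ
  | cons z l ih =>
    have hn' := (List.nodup_cons.1 hn).2
    have hyz : y ≠ z := by rintro rfl; simp at hn'
    rw [List.formPerm_cons_cons, h _ _ hs (List.isCycle_formPerm hn' (by simp))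
      ⟨x, List.formPerm_apply_of_notMem (List.nodup_cons.1 hn).1, by simpa using hxy.symm⟩,
      ih y z hn' hyz ⟨y, z, hyz, rfl⟩, hχ.apply_eq_of_isSwap hs hτ, List.length_cons,
      pow_succ' _ (l.length + 1)]

theorem IsCyclicDirichletChar.apply_swap_mul {p : ℕ} {χ : Perm (Fin p) → ℂ}
    (h : IsCyclicDirichletChar χ) {γ : Perm (Fin p)} (hγ : γ.IsCycle) {x y : Fin p}
    (hxy : x ≠ y) (hx : γ x = x) : χ (swap x y * γ) = χ (swap x y) * χ γ := by
  have hs : (swap x y).IsSwap := ⟨x, y, hxy, rfl⟩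
  by_cases hy : γ y = y
  · refine h.1.2.2 _ _ fun z => ?_
    by_cases hzx : z = x
    · exact .inr (hzx ▸ hx)
    by_cases hzy : z = y
    · exact .inr (hzy ▸ hy)
    exact .inl (swap_apply_of_ne_of_ne hzx hzy)
  · obtain ⟨l, hn, hl, rfl⟩ := hγ.exists_formPerm_cons hy
    have h2 : 2 ≤ (y :: l).length := by simpa using hl
    have hxl : x ∉ y :: l := fun hm =>
      (List.formPerm_apply_mem_ne_self_iff _ hn x hm).2 h2 hx
    have hn' : (x :: y :: l).Nodup := List.nodup_cons.2 ⟨hxl, hn⟩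
    rw [← List.formPerm_cons_cons,
      h.2 _ _ (swap x y) (List.isCycle_formPerm hn' (by simp))
        (List.card_support_formPerm hn' (by simp)) hs,
      h.2 _ _ (swap x y) hγ (List.card_support_formPerm hn h2) hs, ← pow_succ']
    congr 1

end

theorem isCyclic_characterization (p : ℕ) (hp : 0 < p) (χ : Equiv.Perm (Fin p) → ℂ)
    (hχ : IsDirichletChar χ) :
    IsCyclicDirichletChar χ ↔
      ((∀ σ σ' : Equiv.Perm (Fin p), cycleCount σ = cycleCount σ' → χ σ = χ σ') ∧
        ∀ τ γ : Equiv.Perm (Fin p), τ.IsSwap → γ.IsCycle →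
          (∃ x : Fin p, γ x = x ∧ τ x ≠ x) → χ (τ * γ) = χ τ * χ γ) := by
  constructor
  · refine fun h => ⟨fun σ σ' hc => ?_, ?_⟩
    · by_cases hs : ∃ τ : Equiv.Perm (Fin p), τ.IsSwap
      · obtain ⟨τ, hτ⟩ := hs
        obtain ⟨h₁, e₁⟩ := h.apply_eq_pow hτ σ
        obtain ⟨h₂, e₂⟩ := h.apply_eq_pow hτ σ'
        have l₁ := σ.support.card_le_univ
        have l₂ := σ'.support.card_le_univ
        rw [Fintype.card_fin] at l₁ l₂
        rw [e₁, e₂]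
        unfold cycleCount at hc
        congr 1
        omega
      · have : Subsingleton (Fin p) :=
          ⟨fun a b => by_contra fun hab => hs ⟨Equiv.swap a b, a, b, hab, rfl⟩⟩
        rw [Subsingleton.elim σ σ']
    · rintro _ γ ⟨a, b, hab, rfl⟩ hγ ⟨x, hx, hτx⟩
      obtain ⟨-, rfl | rfl⟩ := Equiv.swap_apply_ne_self_iff.1 hτx
      · exact h.apply_swap_mul hγ hab hx
      · rw [Equiv.swap_comm]
        exact h.apply_swap_mul hγ hab.symm hx
  · rintro ⟨-, h⟩
    refine ⟨hχ, ?_⟩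
    rintro _ γ τ hγ rfl hτ
    obtain ⟨y, hy, -⟩ := id hγ
    obtain ⟨l, hn, hl, rfl⟩ := hγ.exists_formPerm_cons hy
    cases l with
    | nil => simp at hl
    | cons z l =>
      rw [hχ.apply_formPerm h hτ l y z hn, List.card_support_formPerm hn (by simp)]
      rfl
end

section
/- Let p ≥ 2 be an integer and let z ∈ ℂ. Then there exists exactly one cyclic Dirichlet character χ: Σ_p → ℂ such that χ(τ) = z for every transposition τ ∈ Σ_p. -/
/-- The cyclic Dirichlet character with value `z` on transpositions: each cycle of length `i`
contributes a factor `z ^ (i - 1)`. -/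
def cyclicChar {p : ℕ} (z : ℂ) (σ : Equiv.Perm (Fin p)) : ℂ :=
  (σ.cycleType.map fun i => z ^ (i - 1)).prod

theorem cyclicChar_of_isCycle {p : ℕ} (z : ℂ) {σ : Equiv.Perm (Fin p)} (hσ : σ.IsCycle) :
    cyclicChar z σ = z ^ (σ.support.card - 1) := by
  simp [cyclicChar, hσ.cycleType]

theorem cyclicChar_of_isSwap {p : ℕ} (z : ℂ) {τ : Equiv.Perm (Fin p)} (hτ : τ.IsSwap) :
    cyclicChar z τ = z := by
  simp [cyclicChar_of_isCycle z hτ.isCycle, Equiv.Perm.card_support_eq_two.2 hτ]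

theorem isDirichletChar_cyclicChar {p : ℕ} (z : ℂ) :
    IsDirichletChar (cyclicChar z : Equiv.Perm (Fin p) → ℂ) :=
  ⟨fun σ τ => by simp [cyclicChar, Equiv.Perm.cycleType_conj], by simp [cyclicChar],
    fun σ₁ σ₂ h => by simp [cyclicChar, h.cycleType_mul]⟩

theorem isCyclicDirichletChar_cyclicChar {p : ℕ} (z : ℂ) :
    IsCyclicDirichletChar (cyclicChar z : Equiv.Perm (Fin p) → ℂ) := by
  refine ⟨isDirichletChar_cyclicChar z, ?_⟩
  rintro _ γ τ hγ rfl hτ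
  rw [cyclicChar_of_isSwap z hτ, cyclicChar_of_isCycle z hγ]

/-- Dirichlet characters are determined by their values on cycles. -/
theorem IsDirichletChar.ext_of_isCycle {p : ℕ} {χ ψ : Equiv.Perm (Fin p) → ℂ}
    (hχ : IsDirichletChar χ) (hψ : IsDirichletChar ψ)
    (h : ∀ γ : Equiv.Perm (Fin p), γ.IsCycle → χ γ = ψ γ) : χ = ψ := by
  funext σ
  induction σ using Equiv.Perm.cycle_induction_on with
  | base_one => rw [hχ.2.1, hψ.2.1]
  | base_cycles γ hγ => exact h γ hγ
  | induction_disjoint σ τ hd _ ihσ ihτ => rw [hχ.2.2 _ _ hd, hψ.2.2 _ _ hd, ihσ, ihτ]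

theorem existsUnique_cyclic_char (p : ℕ) (hp : 2 ≤ p) (z : ℂ) :
    ∃! χ : Equiv.Perm (Fin p) → ℂ,
      IsCyclicDirichletChar χ ∧ ∀ τ : Equiv.Perm (Fin p), τ.IsSwap → χ τ = z := by
  refine ⟨cyclicChar z, ⟨isCyclicDirichletChar_cyclicChar z,
    fun τ => cyclicChar_of_isSwap z⟩, ?_⟩
  rintro χ ⟨hχ, hz⟩
  refine hχ.1.ext_of_isCycle (isDirichletChar_cyclicChar z) fun γ hγ => ?_
  have hτ : (Equiv.swap (⟨0, by omega⟩ : Fin p) ⟨1, by omega⟩).IsSwap :=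
    ⟨_, _, by simp, rfl⟩
  rw [hχ.2 _ γ _ hγ rfl hτ, hz _ hτ, cyclicChar_of_isCycle z hγ]
end

section
/- Let k be a nonnegative integer. Then limsup_{p→∞} ( Σ_{α∈Σ_p} Σ_{β∈Σ_{p+k}} 2^{c(α)·c(β) − c(α)·(p+k)/2} ) / 2^{p(p+k)/2} ≤ 1, where 2^x denotes the real power for real exponents x. Equivalently, limsup_{p→∞} ((χ_{1/2}, χ_{2^{(p+k)/2}})) · p!·(p+k)! / 2^{p(p+k)/2} ≤ 1, where ((χ,χ′)) is the twisted product of cyclic Dirichlet characters. -/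
open Equiv Filter Topology

/-- The number of orbits of a permutation. -/
noncomputable def orbitCount {n : ℕ} (σ : Perm (Fin n)) : ℕ :=
  Nat.card (Quotient (Perm.SameCycle.setoid σ))

theorem cycleCount_le_orbitCount {n : ℕ} (σ : Perm (Fin n)) : cycleCount σ ≤ orbitCount σ := by
  classical
  have hne (c : σ.cycleFactorsFinset) : ∃ x, x ∈ (c : Perm (Fin n)).support := by
    have hc := (Perm.mem_cycleFactorsFinset_iff.1 c.2).1
    obtain ⟨x, hx, -⟩ := hc
    exact ⟨x, Perm.mem_support.2 hx⟩
  choose f hf using hne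
  have hfσ (c : σ.cycleFactorsFinset) : f c ∈ σ.support :=
    Perm.mem_cycleFactorsFinset_support_le c.2 (hf c)
  let g : σ.cycleFactorsFinset ⊕ {x // x ∈ σ.supportᶜ} → Quotient (Perm.SameCycle.setoid σ) :=
    Sum.elim (fun c => Quotient.mk _ (f c)) (fun x => Quotient.mk _ x.1)
  have hg : Function.Injective g := by
    rintro (c | x) (d | y) h
    · have h' : σ.SameCycle (f c) (f d) := Quotient.exact h
      have := h'.cycleOf_eq
      rw [← Perm.cycle_is_cycleOf (hf c) c.2, ← Perm.cycle_is_cycleOf (hf d) d.2] at this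
      exact congrArg _ (Subtype.ext this)
    · have h' : σ.SameCycle (f c) y := Quotient.exact h
      exact absurd (h'.mem_support_iff.1 (hfσ c)) (Finset.mem_compl.1 y.2)
    · have h' : σ.SameCycle x (f d) := Quotient.exact h
      exact absurd (h'.mem_support_iff.2 (hfσ d)) (Finset.mem_compl.1 x.2)
    · have h' : σ.SameCycle x y := Quotient.exact h
      have hx : σ x = x := Perm.notMem_support.1 (Finset.mem_compl.1 x.2)
      exact congrArg _ (Subtype.ext (h'.eq_of_left hx))
  have := Nat.card_le_card_of_injective g hg
  rw [Nat.card_sum, Nat.card_eq_fintype_card, Nat.card_eq_fintype_card, Fintype.card_coe,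
    Fintype.card_coe, Finset.card_compl, Fintype.card_fin] at this
  simpa [cycleCount, orbitCount, Perm.cycleType_def] using this

theorem sameCycle_decomposeFin_symm_succ {n : ℕ} (p : Fin (n + 1)) (e : Perm (Fin n))
    {x y : Fin n} (h : e.SameCycle x y) :
    (Perm.decomposeFin.symm (p, e)).SameCycle x.succ y.succ := by
  have step (z : Fin n) : (Perm.decomposeFin.symm (p, e)).SameCycle z.succ (e z).succ := by
    by_cases hp : (e z).succ = p
    · have h0 : Perm.decomposeFin.symm (p, e) z.succ = 0 := by
        rw [Perm.decomposeFin_symm_apply_succ, hp, swap_apply_right]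
      have h1 := Perm.decomposeFin_symm_apply_zero p e
      rw [hp, ← Perm.sameCycle_apply_left, h0, ← Perm.sameCycle_apply_left, h1]
    · have h0 : Perm.decomposeFin.symm (p, e) z.succ = (e z).succ := by
        rw [Perm.decomposeFin_symm_apply_succ, swap_apply_of_ne_of_ne (Fin.succ_ne_zero _) hp]
      rw [← h0, Perm.sameCycle_apply_right]
  obtain ⟨i, hi⟩ := h.exists_nat_pow_eq
  rw [← hi]
  clear hi h
  induction i with
  | zero => exact Perm.SameCycle.refl _ _
  | succ i ih =>
    rw [pow_succ', Perm.mul_apply]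
    exact ih.trans (step _)

theorem orbitCount_decomposeFin_symm_zero_le {n : ℕ} (e : Perm (Fin n)) :
    orbitCount (Perm.decomposeFin.symm (0, e)) ≤ orbitCount e + 1 := by
  let f : Option (Quotient (Perm.SameCycle.setoid e)) →
      Quotient (Perm.SameCycle.setoid (Perm.decomposeFin.symm (0, e))) := fun o =>
    o.elim (Quotient.mk _ 0) (Quotient.map' Fin.succ
      fun _ _ h => sameCycle_decomposeFin_symm_succ 0 e h)
  have hf : Function.Surjective f := by
    intro y
    induction y using Quotient.inductionOn with
    | h y =>
      refine Fin.cases ⟨none, rfl⟩ (fun i => ⟨some (Quotient.mk _ i), rfl⟩) y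
  simpa [orbitCount, Finite.card_option] using Nat.card_le_card_of_surjective f hf

theorem orbitCount_decomposeFin_symm_succ_le {n : ℕ} (p : Fin n) (e : Perm (Fin n)) :
    orbitCount (Perm.decomposeFin.symm (p.succ, e)) ≤ orbitCount e := by
  let f : Quotient (Perm.SameCycle.setoid e) →
      Quotient (Perm.SameCycle.setoid (Perm.decomposeFin.symm (p.succ, e))) :=
    Quotient.map' Fin.succ fun _ _ h => sameCycle_decomposeFin_symm_succ p.succ e h
  have hf : Function.Surjective f := by
    intro y
    induction y using Quotient.inductionOn with
    | h y =>
      refine Fin.cases ⟨Quotient.mk _ p, Quotient.sound ?_⟩ (fun i => ⟨Quotient.mk _ i, rfl⟩) y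
      change (Perm.decomposeFin.symm (p.succ, e)).SameCycle p.succ 0
      rw [← Perm.sameCycle_apply_right, Perm.decomposeFin_symm_apply_zero]
  exact Nat.card_le_card_of_surjective f hf

theorem sum_pow_orbitCount_le {x : ℝ} (hx : 1 ≤ x) (n : ℕ) :
    ∑ σ : Perm (Fin n), x ^ orbitCount σ ≤ ∏ i ∈ Finset.range n, (x + i) := by
  induction n with
  | zero => simp [orbitCount]
  | succ n ih =>
    rw [Finset.prod_range_succ, ← Perm.decomposeFin.symm.sum_comp, Fintype.sum_prod_type,
      Fin.sum_univ_succ]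
    have h0 : ∑ e : Perm (Fin n), x ^ orbitCount (Perm.decomposeFin.symm (0, e)) ≤
        (∑ e : Perm (Fin n), x ^ orbitCount e) * x := by
      rw [Finset.sum_mul]
      refine Finset.sum_le_sum fun e _ => ?_
      rw [← pow_succ]
      exact pow_le_pow_right₀ hx (orbitCount_decomposeFin_symm_zero_le e)
    have h1 : ∑ p : Fin n, ∑ e : Perm (Fin n), x ^ orbitCount (Perm.decomposeFin.symm (p.succ, e)) ≤
        (∑ e : Perm (Fin n), x ^ orbitCount e) * n := by
      calc _ ≤ ∑ _p : Fin n, ∑ e : Perm (Fin n), x ^ orbitCount e :=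
            Finset.sum_le_sum fun p _ => Finset.sum_le_sum fun e _ =>
              pow_le_pow_right₀ hx (orbitCount_decomposeFin_symm_succ_le p e)
        _ = _ := by simp [mul_comm]
    calc _ ≤ (∑ e : Perm (Fin n), x ^ orbitCount e) * (x + n) := by
          rw [mul_add]; exact add_le_add h0 h1
      _ ≤ _ := by gcongr

theorem sum_pow_cycleCount_le {x : ℝ} (hx : 1 ≤ x) (n : ℕ) :
    ∑ σ : Perm (Fin n), x ^ cycleCount σ ≤ (x + n) ^ n := by
  calc ∑ σ : Perm (Fin n), x ^ cycleCount σ ≤ ∑ σ : Perm (Fin n), x ^ orbitCount σ :=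
        Finset.sum_le_sum fun σ _ => pow_le_pow_right₀ hx (cycleCount_le_orbitCount σ)
    _ ≤ ∏ i ∈ Finset.range n, (x + i) := sum_pow_orbitCount_le hx n
    _ ≤ ∏ _i ∈ Finset.range n, (x + n) := by
        refine Finset.prod_le_prod (fun i _ => by positivity) fun i hi => ?_
        have : (i : ℝ) ≤ n := by exact_mod_cast (Finset.mem_range.1 hi).le
        gcongr
    _ = _ := by simp

theorem cycleCount_one (n : ℕ) : cycleCount (1 : Perm (Fin n)) = n := by
  simp [cycleCount]

theorem cycleCount_lt {n : ℕ} {σ : Perm (Fin n)} (hσ : σ ≠ 1) : cycleCount σ < n := by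
  have h1 := Perm.card_cycleType_pos.2 hσ
  have h2 : Multiset.card σ.cycleType • 2 ≤ σ.cycleType.sum :=
    Multiset.card_nsmul_le_sum fun _ => Perm.two_le_of_mem_cycleType
  have h3 : σ.support.card ≤ n := by simpa using Finset.card_le_univ σ.support
  rw [Perm.sum_cycleType, smul_eq_mul] at h2
  unfold cycleCount
  omega

theorem add_pow_div_pow_le_exp {x : ℝ} (hx : 0 < x) (n : ℕ) :
    (x + n) ^ n / x ^ n ≤ Real.exp ((n : ℝ) ^ 2 / x) := by
  have h : (n : ℝ) ^ 2 / x = n * (n / x) := by ring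
  rw [← div_pow, h, Real.exp_nat_mul, add_div, div_self hx.ne', add_comm]
  gcongr
  exact Real.add_one_le_exp _

theorem two_pow_add_le {s : ℝ} (hs : 1 ≤ s) (hs8 : s ^ 8 = 2) {a p q : ℕ} (ha : a < p)
    (h1 : (q : ℝ) + 1 ≤ s ^ p) (h2 : (q : ℝ) ≤ (s ^ 2 - 1) * s ^ p) :
    (2 : ℝ) ^ a + q ≤ s ^ (8 * a + 2 * (p - a)) := by
  have h2a : (2 : ℝ) ^ a = s ^ (8 * a) := by rw [pow_mul, hs8]
  have h2a1 : 1 ≤ s ^ (8 * a) := one_le_pow₀ hs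
  rw [pow_add, h2a]
  by_cases hap : p ≤ 2 * a
  · have h3 : s ^ 2 ≤ s ^ (2 * (p - a)) := pow_le_pow_right₀ hs (by omega)
    have h4 : s ^ p ≤ s ^ (8 * a) := pow_le_pow_right₀ hs (by omega)
    have h5 : 0 ≤ s ^ 2 - 1 := sub_nonneg.2 (one_le_pow₀ hs)
    nlinarith
  · have h3 : s ^ p ≤ s ^ (2 * (p - a)) := pow_le_pow_right₀ hs (by omega)
    have h4 : (0 : ℝ) ≤ q := q.cast_nonneg
    nlinarith

theorem sum_sum_le_exp {s : ℝ} (hs : 1 ≤ s) (hs8 : s ^ 8 = 2) {p q : ℕ}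
    (h1 : (q : ℝ) + 1 ≤ s ^ p) (h2 : (q : ℝ) ≤ (s ^ 2 - 1) * s ^ p) :
    ∑ α : Perm (Fin p), (∑ β : Perm (Fin q), ((2 : ℝ) ^ cycleCount α) ^ cycleCount β) /
        s ^ (4 * q * (cycleCount α + p)) ≤
      Real.exp ((q : ℝ) ^ 2 / 2 ^ p) + (Real.exp ((p : ℝ) ^ 2 / s ^ (2 * q)) - 1) := by
  classical
  have hs0 : 0 < s := by linarith
  have hβ (a : ℕ) : ∑ β : Perm (Fin q), ((2 : ℝ) ^ a) ^ cycleCount β ≤ (2 ^ a + q) ^ q :=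
    sum_pow_cycleCount_le (one_le_pow₀ one_le_two) q
  rw [← Finset.add_sum_erase _ _ (Finset.mem_univ (1 : Perm (Fin p)))]
  refine add_le_add ?_ ?_
  · rw [cycleCount_one]
    refine le_trans ?_ (add_pow_div_pow_le_exp (by positivity) q)
    have : ((2 : ℝ) ^ p) ^ q = s ^ (4 * q * (p + p)) := by
      rw [← hs8, ← pow_mul, ← pow_mul]; ring_nf
    rw [this]
    gcongr
    exact hβ p
  · have hX : 1 ≤ s ^ (2 * q) := one_le_pow₀ hs
    have key : ∑ α : Perm (Fin p), (s ^ (2 * q)) ^ cycleCount α / (s ^ (2 * q)) ^ p ≤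
        Real.exp ((p : ℝ) ^ 2 / s ^ (2 * q)) := by
      rw [← Finset.sum_div]
      refine le_trans ?_ (add_pow_div_pow_le_exp (by positivity) p)
      gcongr
      exact sum_pow_cycleCount_le hX p
    rw [← Finset.add_sum_erase _ _ (Finset.mem_univ (1 : Perm (Fin p))), cycleCount_one,
      div_self (by positivity)] at key
    refine le_trans (Finset.sum_le_sum fun α hα => ?_) (le_sub_iff_add_le'.2 key)
    have ha := cycleCount_lt (Finset.ne_of_mem_erase hα)
    rw [div_le_div_iff₀ (by positivity) (by positivity)]
    generalize cycleCount α = a at ha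
    calc _ ≤ (s ^ (8 * a + 2 * (p - a))) ^ q * (s ^ (2 * q)) ^ p := by
          gcongr
          exact (hβ a).trans (pow_le_pow_left₀ (by positivity) (two_pow_add_le hs hs8 ha h1 h2) q)
      _ = _ := by
          obtain ⟨d, rfl⟩ := Nat.exists_eq_add_of_lt ha
          rw [show a + d + 1 - a = d + 1 by omega]
          simp only [← pow_mul, ← pow_add]
          ring_nf

theorem summand_eq {s : ℝ} (hs : 0 < s) (hs8 : s ^ 8 = 2) (a b p k : ℕ) :
    (2 : ℝ) ^ ((a : ℝ) * (b : ℝ) - (a : ℝ) * ((p : ℝ) + (k : ℝ)) / 2) /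
        (2 : ℝ) ^ ((p : ℝ) * ((p : ℝ) + (k : ℝ)) / 2) =
      ((2 : ℝ) ^ a) ^ b / s ^ (4 * (p + k) * (a + p)) := by
  have h (x : ℝ) : (2 : ℝ) ^ x = s ^ (8 * x) := by
    rw [← hs8, ← Real.rpow_natCast s 8, ← Real.rpow_mul hs.le]; norm_num
  rw [← Real.rpow_sub two_pos, ← pow_mul, ← Real.rpow_natCast 2, h, h, ← Real.rpow_natCast s,
    ← Real.rpow_sub hs]
  congr 1
  push_cast
  ring

theorem tendsto_add_pow_div_pow {s : ℝ} (hs : 1 < s) (k m : ℕ) :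
    Tendsto (fun p : ℕ => ((p + k : ℕ) : ℝ) ^ m / s ^ p) atTop (𝓝 0) := by
  have h := (tendsto_pow_const_div_const_pow_of_one_lt m hs).comp (tendsto_add_atTop_nat k)
  have h' := h.mul_const (s ^ k)
  rw [zero_mul] at h'
  refine h'.congr fun p => ?_
  have : s ≠ 0 := by positivity
  simp only [Function.comp_apply, pow_add]
  field_simp


theorem twisted_product_growth (k : ℕ) :
    Filter.limsup
      (fun p : ℕ =>
        (∑ α : Equiv.Perm (Fin p), ∑ β : Equiv.Perm (Fin (p + k)),
            (2 : ℝ) ^ ((cycleCount α : ℝ) * (cycleCount β : ℝ)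
              - (cycleCount α : ℝ) * ((p : ℝ) + (k : ℝ)) / 2)) /
          (2 : ℝ) ^ ((p : ℝ) * ((p : ℝ) + (k : ℝ)) / 2))
      Filter.atTop ≤ 1 := by
  obtain ⟨s, hs, hs8⟩ : ∃ s : ℝ, 1 < s ∧ s ^ 8 = 2 :=
    ⟨2 ^ (1 / 8 : ℝ), Real.one_lt_rpow one_lt_two (by norm_num), by
      rw [← Real.rpow_natCast, ← Real.rpow_mul two_pos.le]; norm_num⟩
  have hs0 : 0 < s := by linarith
  have hs2 : 1 < s ^ 2 := one_lt_pow₀ hs two_ne_zero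
  have hlim : Tendsto (fun p : ℕ => Real.exp (((p + k : ℕ) : ℝ) ^ 2 / 2 ^ p) +
      (Real.exp ((p : ℝ) ^ 2 / s ^ (2 * (p + k))) - 1)) atTop (𝓝 1) := by
    have h1 := (tendsto_add_pow_div_pow one_lt_two k 2).rexp
    have h2 : Tendsto (fun p : ℕ => (p : ℝ) ^ 2 / s ^ (2 * (p + k))) atTop (𝓝 0) := by
      refine squeeze_zero (fun p => by positivity) (fun p => ?_)
        (tendsto_pow_const_div_const_pow_of_one_lt 2 hs)
      gcongr
      exacts [hs.le, by omega]
    simpa using h1.add (h2.rexp.sub_const 1)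
  have hle : ∀ᶠ p : ℕ in atTop, ((p + k : ℕ) : ℝ) + 1 ≤ s ^ p ∧
      ((p + k : ℕ) : ℝ) ≤ (s ^ 2 - 1) * s ^ p := by
    have h1 := (tendsto_add_pow_div_pow hs (k + 1) 1).eventually_le_const one_pos
    have h2 := (tendsto_add_pow_div_pow hs k 1).eventually_le_const (sub_pos.2 hs2)
    filter_upwards [h1, h2] with p h1 h2
    rw [div_le_iff₀ (by positivity)] at h1 h2
    push_cast at h1 h2 ⊢
    constructor <;> linarith
  rw [← hlim.limsup_eq]
  refine limsup_le_limsup ?_ ?_ hlim.isBoundedUnder_le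
  · filter_upwards [hle] with p hp
    refine le_trans (le_of_eq ?_) (sum_sum_le_exp hs.le hs8 hp.1 hp.2)
    simp only [Finset.sum_div, summand_eq hs0 hs8]
  · exact (isBoundedUnder_of ⟨0, fun p => by positivity⟩).isCoboundedUnder_le
end

section
/- Let p and q be positive integers, let α and α′ be disjoint permutations in Σ_p, and let β ∈ Σ_q. Then ⟨αα′, β⟩ + ⟨1, β⟩ = ⟨α, β⟩ + ⟨α′, β⟩, where 1 denotes the identity permutation; that is, the group-algebra element (1 − α)(1 − α′) lies in the radical of the cycle form. -/
/-- `c_r(σ)`: the number of `r`-cycles in the disjoint cycle decomposition of `σ`,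
where `c_1(σ)` is the number of fixed points. -/
def cycleCountOf {n : ℕ} (σ : Equiv.Perm (Fin n)) (r : ℕ) : ℕ :=
  if r = 1 then n - σ.support.card else Multiset.count r σ.cycleType

/-- The cycle form `⟨α,β⟩ = Σ_{r,s} gcd(r,s)·c_r(α)·c_s(β)`. -/
def cycleForm {p q : ℕ} (α : Equiv.Perm (Fin p)) (β : Equiv.Perm (Fin q)) : ℕ :=
  ∑ r ∈ Finset.Icc 1 p, ∑ s ∈ Finset.Icc 1 q,
    Nat.gcd r s * (cycleCountOf α r * cycleCountOf β s)

theorem cycleCountOf_mul_add_one {p : ℕ} {α α' : Equiv.Perm (Fin p)}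
    (h : α.Disjoint α') (r : ℕ) :
    cycleCountOf (α * α') r + cycleCountOf (1 : Equiv.Perm (Fin p)) r =
      cycleCountOf α r + cycleCountOf α' r := by
  unfold cycleCountOf
  split_ifs
  · have hcard := h.card_support_mul
    have hle : (α * α').support.card ≤ p := by
      simpa using (α * α').support.card_le_univ
    simp only [Equiv.Perm.support_one, Finset.card_empty]
    lia
  · simp [h.cycleType_mul]

theorem cycleForm_radical (p q : ℕ) (hp : 0 < p) (hq : 0 < q)
    (α α' : Equiv.Perm (Fin p)) (h : α.Disjoint α') (β : Equiv.Perm (Fin q)) :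
    cycleForm (α * α') β + cycleForm (1 : Equiv.Perm (Fin p)) β = cycleForm α β + cycleForm α' β := by
  simp only [cycleForm, ← Finset.sum_add_distrib, ← mul_add, ← add_mul,
    cycleCountOf_mul_add_one h]
end

section
/- Let p, q, ℓ be positive integers with ℓ ≤ p, let γ_ℓ ∈ Σ_p be an ℓ-cycle (with all other points fixed), and let β ∈ Σ_q. Then p·c(β) − ⟨γ_ℓ, β⟩ ≥ (ℓ−1)·(c(β) − q/ℓ), as an inequality of rational numbers; equivalently ⟨1 − γ_ℓ, β⟩ ≥ (ℓ−1)(c(β) − q/ℓ), since ⟨1,β⟩ = p·c(β) for the identity 1 ∈ Σ_p. -/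
theorem cycleCountOf_eq_count_parts {n : ℕ} (σ : Equiv.Perm (Fin n)) (r : ℕ) :
    cycleCountOf σ r = σ.partition.parts.count r := by
  rw [Equiv.Perm.parts_partition, Multiset.count_add, Multiset.count_replicate, cycleCountOf,
    Fintype.card_fin]
  split_ifs with h1 h2 h2
  · have : Multiset.count r σ.cycleType = 0 := Multiset.count_eq_zero.2 fun h => by
      have := Equiv.Perm.two_le_of_mem_cycleType h
      omega
    omega
  · omega
  · omega
  · simp

theorem sum_cycleCountOf_mul {n : ℕ} (σ : Equiv.Perm (Fin n)) (f : ℕ → ℕ) :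
    ∑ r ∈ Finset.Icc 1 n, cycleCountOf σ r * f r = (σ.partition.parts.map f).sum := by
  rw [Finset.sum_multiset_map_count]
  simp_rw [cycleCountOf_eq_count_parts, smul_eq_mul]
  symm
  refine Finset.sum_subset (fun r hr => ?_) fun r _ hr => ?_
  · rw [Multiset.mem_toFinset] at hr
    refine Finset.mem_Icc.2 ⟨σ.partition.parts_pos hr, ?_⟩
    simpa using σ.partition.le_of_mem_parts hr
  · rw [Multiset.mem_toFinset] at hr
    rw [Multiset.count_eq_zero.2 hr, zero_mul]

theorem sum_cycleCountOf {n : ℕ} (σ : Equiv.Perm (Fin n)) :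
    ∑ r ∈ Finset.Icc 1 n, cycleCountOf σ r = cycleCount σ := by
  simpa [Equiv.Perm.parts_partition, cycleCount] using sum_cycleCountOf_mul σ fun _ => 1

theorem sum_cycleCountOf_mul_self {n : ℕ} (σ : Equiv.Perm (Fin n)) :
    ∑ r ∈ Finset.Icc 1 n, cycleCountOf σ r * r = n := by
  simpa [σ.partition.parts_sum] using sum_cycleCountOf_mul σ id

theorem cycleCountOf_cycle {p ℓ : ℕ} (hℓp : ℓ ≤ p) (hℓ : 0 < ℓ) {γ : Equiv.Perm (Fin p)}
    (hγ : if ℓ = 1 then γ = 1 else γ.IsCycle ∧ γ.support.card = ℓ) (r : ℕ) :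
    cycleCountOf γ r = (if r = 1 then p - ℓ else 0) + if r = ℓ then 1 else 0 := by
  unfold cycleCountOf
  by_cases h : ℓ = 1
  · subst h
    rw [if_pos rfl] at hγ
    subst hγ
    split_ifs <;> simp
    omega
  · rw [if_neg h] at hγ
    rw [hγ.1.cycleType, hγ.2, Multiset.count_singleton]
    split_ifs <;> omega

theorem cycleForm_cycle {p q ℓ : ℕ} (hℓp : ℓ ≤ p) (hℓ : 0 < ℓ) {γ : Equiv.Perm (Fin p)}
    (hγ : if ℓ = 1 then γ = 1 else γ.IsCycle ∧ γ.support.card = ℓ) (β : Equiv.Perm (Fin q)) :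
    cycleForm γ β = ∑ s ∈ Finset.Icc 1 q, cycleCountOf β s * (p - ℓ + Nat.gcd ℓ s) := by
  unfold cycleForm
  rw [Finset.sum_comm]
  refine Finset.sum_congr rfl fun s _ => ?_
  have hp : 1 ≤ p := hℓ.trans_le hℓp
  have hℓ' : 1 ≤ ℓ := hℓ
  simp_rw [cycleCountOf_cycle hℓp hℓ hγ, add_mul, mul_add, Finset.sum_add_distrib, ite_mul,
    mul_ite, zero_mul, mul_zero, Finset.sum_ite_eq', Finset.mem_Icc]
  simp [hp, hℓp, hℓ', mul_comm]

theorem mul_gcd_le_add_pred_mul {ℓ s : ℕ} (hℓ : 0 < ℓ) (hs : 0 < s) :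
    (ℓ : ℚ) * (Nat.gcd ℓ s : ℚ) ≤ ℓ + (ℓ - 1) * s := by
  have h1 : (Nat.gcd ℓ s : ℚ) ≤ ℓ := by exact_mod_cast Nat.gcd_le_left s hℓ
  have h2 : (Nat.gcd ℓ s : ℚ) ≤ s := by exact_mod_cast Nat.le_of_dvd hs (Nat.gcd_dvd_right ℓ s)
  have h3 : (1 : ℚ) ≤ ℓ := by exact_mod_cast hℓ
  nlinarith [mul_le_mul_of_nonneg_left h2 (sub_nonneg.2 h3)]

theorem cycleForm_cycle_bound (p q ℓ : ℕ) (hp : 0 < p) (hq : 0 < q) (hℓ : 0 < ℓ)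
    (hℓp : ℓ ≤ p) (γ : Equiv.Perm (Fin p))
    (hγ : if ℓ = 1 then γ = 1 else γ.IsCycle ∧ γ.support.card = ℓ)
    (β : Equiv.Perm (Fin q)) :
    ((p : ℚ) * (cycleCount β : ℚ) - (cycleForm γ β : ℚ)) ≥
      ((ℓ : ℚ) - 1) * ((cycleCount β : ℚ) - (q : ℚ) / (ℓ : ℚ)) := by
  have hℓ0 : (0 : ℚ) < ℓ := by exact_mod_cast hℓ
  have hc : (cycleCount β : ℚ) = ∑ s ∈ Finset.Icc 1 q, (cycleCountOf β s : ℚ) := by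
    exact_mod_cast (sum_cycleCountOf β).symm
  have hq' : (q : ℚ) = ∑ s ∈ Finset.Icc 1 q, (cycleCountOf β s : ℚ) * s := by
    exact_mod_cast (sum_cycleCountOf_mul_self β).symm
  rw [cycleForm_cycle hℓp hℓ hγ, ge_iff_le, hq', hc]
  push_cast [Nat.cast_sub hℓp]
  rw [Finset.sum_div, ← Finset.sum_sub_distrib, Finset.mul_sum, Finset.mul_sum,
    ← Finset.sum_sub_distrib]
  refine Finset.sum_le_sum fun s hs => ?_
  have key : (ℓ - 1) * (1 - (s : ℚ) / ℓ) ≤ ℓ - (Nat.gcd ℓ s : ℚ) := by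
    have h := mul_gcd_le_add_pred_mul hℓ (Finset.mem_Icc.1 hs).1
    rw [← mul_le_mul_iff_right₀ hℓ0]
    field_simp
    linarith
  calc ((ℓ : ℚ) - 1) * (cycleCountOf β s - cycleCountOf β s * s / ℓ)
      = cycleCountOf β s * ((ℓ - 1) * (1 - (s : ℚ) / ℓ)) := by ring
    _ ≤ cycleCountOf β s * (ℓ - (Nat.gcd ℓ s : ℚ)) :=
        mul_le_mul_of_nonneg_left key (Nat.cast_nonneg _)
    _ = _ := by ring
end

section
/- Let p and q be positive integers and let β ∈ Σ_q. Then Σ_{α∈Σ_p} 2^{⟨α,β⟩} ≤ 2^{p·c(β)} · Σ_{α∈Σ_p} 2^{(c(α) − p)·(c(β) − q/2)}, where 2^x denotes the real power for real exponents x. -/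
theorem two_mul_gcd_add_le {r s : ℕ} (hr : 1 ≤ r) (hs : 1 ≤ s) :
    2 * Nat.gcd r s + s ≤ 2 + r * s := by
  have h₁ := Nat.gcd_le_left s hr
  have h₂ := Nat.gcd_le_right r hs
  rcases Nat.lt_or_ge r 3 with h | h
  · interval_cases r
    · simp
    · rcases hs.eq_or_lt with rfl | hs
      · simp
      · omega
  · nlinarith

/-- The pointwise bound `⟨α,β⟩ ≤ c(α) c(β) + (p - c(α)) q / 2`, without subtraction or division. -/
theorem two_mul_cycleForm_add_le {p q : ℕ} (α : Equiv.Perm (Fin p)) (β : Equiv.Perm (Fin q)) :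
    2 * cycleForm α β + cycleCount α * q ≤ 2 * (cycleCount α * cycleCount β) + p * q := by
  have hp := sum_cycleCountOf_mul_self α
  have hq := sum_cycleCountOf_mul_self β
  calc
    _ = 2 * cycleForm α β + (∑ r ∈ Finset.Icc 1 p, cycleCountOf α r) *
          ∑ s ∈ Finset.Icc 1 q, cycleCountOf β s * s := by
      rw [hq, sum_cycleCountOf]
    _ = ∑ r ∈ Finset.Icc 1 p, ∑ s ∈ Finset.Icc 1 q,
          (2 * Nat.gcd r s + s) * (cycleCountOf α r * cycleCountOf β s) := by
      simp only [cycleForm, Finset.sum_mul_sum]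
      simp only [Finset.mul_sum, ← Finset.sum_add_distrib]
      refine Finset.sum_congr rfl fun r _ => Finset.sum_congr rfl fun s _ => ?_
      ring
    _ ≤ ∑ r ∈ Finset.Icc 1 p, ∑ s ∈ Finset.Icc 1 q,
          (2 + r * s) * (cycleCountOf α r * cycleCountOf β s) := by
      refine Finset.sum_le_sum fun r hr => Finset.sum_le_sum fun s hs => ?_
      exact Nat.mul_le_mul_right _
        (two_mul_gcd_add_le (Finset.mem_Icc.1 hr).1 (Finset.mem_Icc.1 hs).1)
    _ = 2 * ((∑ r ∈ Finset.Icc 1 p, cycleCountOf α r) * ∑ s ∈ Finset.Icc 1 q, cycleCountOf β s) +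
          (∑ r ∈ Finset.Icc 1 p, cycleCountOf α r * r) *
            ∑ s ∈ Finset.Icc 1 q, cycleCountOf β s * s := by
      simp only [Finset.sum_mul_sum]
      simp only [Finset.mul_sum, ← Finset.sum_add_distrib]
      refine Finset.sum_congr rfl fun r _ => Finset.sum_congr rfl fun s _ => ?_
      ring
    _ = _ := by rw [hp, hq, sum_cycleCountOf, sum_cycleCountOf]

theorem sum_two_pow_cycleForm_le (p q : ℕ) (hp : 0 < p) (hq : 0 < q)
    (β : Equiv.Perm (Fin q)) :
    ∑ α : Equiv.Perm (Fin p), (2 : ℝ) ^ (cycleForm α β) ≤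
      (2 : ℝ) ^ (p * cycleCount β) *
        ∑ α : Equiv.Perm (Fin p),
          (2 : ℝ) ^ (((cycleCount α : ℝ) - (p : ℝ)) *
            ((cycleCount β : ℝ) - (q : ℝ) / 2)) := by
  rw [Finset.mul_sum]
  refine Finset.sum_le_sum fun α _ => ?_
  rw [← Real.rpow_natCast, ← Real.rpow_natCast, ← Real.rpow_add two_pos]
  refine Real.rpow_le_rpow_of_exponent_le one_le_two ?_
  have h : (2 * cycleForm α β + cycleCount α * q : ℝ) ≤
      2 * (cycleCount α * cycleCount β) + p * q := by
    exact_mod_cast two_mul_cycleForm_add_le α β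
  push_cast
  linarith
end

section
/- Let k be a nonnegative integer. Then lim_{p→∞} (2^{p+k})^{\overline{p}} / (2^{p+k})^p = 1, where x^{\overline{p}} = x(x+1)···(x+p−1) is the rising factorial; equivalently, lim_{p→∞} (p + 2^{p+k} − 1)! / ( 2^{p(p+k)} · (2^{p+k} − 1)! ) = 1, so the binomial expression C(p + 2^{p+k} − 1, p) / (p+k)! and 2^{p(p+k)} / (p!·(p+k)!) have the same asymptotic growth as p → ∞. -/
theorem one_le_prod_range_add_div_pow {x : ℝ} (hx : 0 < x) (p : ℕ) :
    1 ≤ (∏ i ∈ Finset.range p, (x + (i : ℝ))) / x ^ p := by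
  rw [one_le_div (by positivity)]
  calc x ^ p = ∏ _i ∈ Finset.range p, x := by simp
    _ ≤ ∏ i ∈ Finset.range p, (x + (i : ℝ)) :=
      Finset.prod_le_prod (fun _ _ => hx.le) fun i _ => le_add_of_nonneg_right i.cast_nonneg

theorem prod_range_add_div_pow_le_exp {x : ℝ} (hx : 0 < x) (p : ℕ) :
    (∏ i ∈ Finset.range p, (x + (i : ℝ))) / x ^ p ≤ Real.exp ((p : ℝ) ^ 2 / x) := by
  calc (∏ i ∈ Finset.range p, (x + (i : ℝ))) / x ^ p
      ≤ (x + p) ^ p / x ^ p := by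
        gcongr
        calc ∏ i ∈ Finset.range p, (x + (i : ℝ)) ≤ ∏ _i ∈ Finset.range p, (x + (p : ℝ)) := by
              refine Finset.prod_le_prod (fun i _ => by positivity) fun i hi => ?_
              gcongr
              exact (Finset.mem_range.mp hi).le
          _ = (x + p) ^ p := by simp
    _ = (p / x + 1) ^ p := by
        rw [← div_pow, add_div, div_self hx.ne', add_comm]
    _ ≤ Real.exp (p / x) ^ p := by
        gcongr
        exact Real.add_one_le_exp _
    _ = Real.exp ((p : ℝ) ^ 2 / x) := by
        rw [← Real.exp_nat_mul]
        ring_nf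

theorem risingFactorial_ratio_tendsto_one (k : ℕ) :
    Filter.Tendsto
      (fun p : ℕ =>
        (∏ i ∈ Finset.range p, ((2 : ℝ) ^ (p + k) + (i : ℝ))) / ((2 : ℝ) ^ (p + k)) ^ p)
      Filter.atTop (nhds 1) := by
  have h : Filter.Tendsto (fun p : ℕ => Real.exp ((p : ℝ) ^ 2 / (2 : ℝ) ^ p))
      Filter.atTop (nhds 1) := by
    rw [← Real.exp_zero]
    exact (Real.continuous_exp.tendsto 0).comp
      (tendsto_pow_const_div_const_pow_of_one_lt 2 one_lt_two)
  refine tendsto_of_tendsto_of_tendsto_of_le_of_le tendsto_const_nhds h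
    (fun p => one_le_prod_range_add_div_pow (by positivity) p) fun p => ?_
  refine (prod_range_add_div_pow_le_exp (by positivity) p).trans ?_
  gcongr
  · exact one_le_two
  · exact Nat.le_add_right p k
end
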